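/- There exists a universal constant γ > 0 such that for all K, M, N ∈ ℕ with N = KM and every x ∈ ℝ^N with ∑_i x_i = 0: (1) |x − E(Px)|² ≤ (γ/M²)⟨Ax, x⟩, and (2) ⟨A^{-1}(x − E(Px)), x − E(Px)⟩ ≤ (γ/M²)|x|², where |·| and ⟨·,·⟩ are the Euclidean norm and inner product on ℝ^N. -/

import Mathlib

open MeasureTheory Real

noncomputable section

/-- The discrete (periodic) operator `A`, `(Ax)ᵢ = N²(-x_{i-1} + 2xᵢ - x_{i+1})`. -/
def Amat (N : ℕ) (x : Fin N → ℝ) : Fin N → ℝ := fun i =>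
  (N : ℝ) ^ 2 * (2 * x i - x ⟨(i.val + 1) % N, Nat.mod_lt _ i.pos⟩
    - x ⟨(i.val + (N - 1)) % N, Nat.mod_lt _ i.pos⟩)

/-- The index of the `j`-th spin of the `i`-th block, for the decomposition `N = K·M`. -/
def blockIdx (K M : ℕ) (i : Fin M) (j : Fin K) : Fin (K * M) :=
  ⟨i.val * K + j.val, by
    have h1 : i.val + 1 ≤ M := i.isLt
    have h2 : j.val < K := j.isLt
    calc i.val * K + j.val < i.val * K + K := by omega
      _ = (i.val + 1) * K := by ring
      _ ≤ M * K := Nat.mul_le_mul_right K h1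
      _ = K * M := Nat.mul_comm M K⟩

/-- The block containing a given site. -/
def blockOf (K M : ℕ) (j : Fin (K * M)) : Fin M :=
  ⟨j.val / K, Nat.div_lt_of_lt_mul j.isLt⟩

/-- `E(Px)`: each block of `K` coordinates is replaced by its block average. -/
def EP (K M : ℕ) (x : Fin (K * M) → ℝ) (j : Fin (K * M)) : ℝ :=
  (1 / (K : ℝ)) * ∑ j' : Fin K, x (blockIdx K M (blockOf K M j) j')

/-- The cyclic shift `i ↦ i + 1` on `Fin N`. -/
def cyclicShift (N : ℕ) : Fin N ≃ Fin N where
  toFun i := ⟨(i.val + 1) % N, Nat.mod_lt _ i.pos⟩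
  invFun i := ⟨(i.val + (N - 1)) % N, Nat.mod_lt _ i.pos⟩
  left_inv i := by
    ext
    have := i.isLt
    simp only [Nat.mod_add_mod]
    rw [show i.val + 1 + (N - 1) = i.val + N by omega, Nat.add_mod_right, Nat.mod_eq_of_lt this]
  right_inv i := by
    ext
    have := i.isLt
    simp only [Nat.mod_add_mod]
    rw [show i.val + (N - 1) + 1 = i.val + N by omega, Nat.add_mod_right, Nat.mod_eq_of_lt this]

theorem sum_Amat_mul_self (N : ℕ) (x : Fin N → ℝ) :
    ∑ i, Amat N x i * x i = (N : ℝ) ^ 2 * ∑ i, (x (cyclicShift N i) - x i) ^ 2 := by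
  have h1 : ∑ i, x ((cyclicShift N).symm i) * x i = ∑ i, x i * x (cyclicShift N i) := by
    rw [← Equiv.sum_comp (cyclicShift N)]
    simp
  have h2 : ∑ i, x (cyclicShift N i) ^ 2 = ∑ i, x i ^ 2 :=
    Equiv.sum_comp (cyclicShift N) fun i => x i ^ 2
  have h3 : ∀ i, Amat N x i * x i = (N : ℝ) ^ 2 * (2 * x i ^ 2 - x i * x (cyclicShift N i)
      - x ((cyclicShift N).symm i) * x i) := fun i => by
    simp only [Amat, cyclicShift, Equiv.coe_fn_mk, Equiv.coe_fn_symm_mk]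
    ring
  simp only [h3, ← Finset.mul_sum, Finset.sum_sub_distrib, h1, sub_sq, Finset.sum_add_distrib, h2]
  rw [show ∑ i, 2 * x (cyclicShift N i) * x i = 2 * ∑ i, x i * x (cyclicShift N i) by
    rw [Finset.mul_sum]; exact Finset.sum_congr rfl fun i _ => by ring]
  ring

theorem sum_eq_sum_blocks (K M : ℕ) (f : Fin (K * M) → ℝ) :
    ∑ l, f l = ∑ i, ∑ j, f (blockIdx K M i j) := by
  rw [← Fintype.sum_prod_type' fun i j => f (blockIdx K M i j),
    ← Equiv.sum_comp (finProdFinEquiv.trans (finCongr (Nat.mul_comm M K)))]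
  refine Finset.sum_congr rfl fun p _ => congrArg f (Fin.ext ?_)
  simp [blockIdx]
  ring

theorem blockOf_blockIdx (K M : ℕ) (i : Fin M) (j : Fin K) :
    blockOf K M (blockIdx K M i j) = i := by
  ext
  simp [blockOf, blockIdx, Nat.mul_add_div j.pos, Nat.mul_comm i.val K, Nat.div_eq_of_lt j.isLt]

theorem EP_blockIdx (K M : ℕ) (x : Fin (K * M) → ℝ) (i : Fin M) (j : Fin K) :
    EP K M x (blockIdx K M i j) = (1 / (K : ℝ)) * ∑ j', x (blockIdx K M i j') := by
  rw [EP, blockOf_blockIdx]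

theorem sum_sub_average_eq_zero {K : ℕ} (f : Fin K → ℝ) :
    ∑ j, (f j - (1 / (K : ℝ)) * ∑ j', f j') = 0 := by
  rcases Nat.eq_zero_or_pos K with rfl | hK
  · simp
  · have : (K : ℝ) ≠ 0 := by positivity
    simp only [Finset.sum_sub_distrib, Finset.sum_const, Finset.card_univ, Fintype.card_fin,
      nsmul_eq_mul]
    field_simp
    ring

theorem sum_sub_average_sq_le {K : ℕ} (f : Fin K → ℝ) (c : ℝ) :
    ∑ j, (f j - (1 / (K : ℝ)) * ∑ j', f j') ^ 2 ≤ ∑ j, (f j - c) ^ 2 := by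
  set a := (1 / (K : ℝ)) * ∑ j', f j'
  have h0 : ∑ j, (f j - a) = 0 := sum_sub_average_eq_zero f
  have h : ∑ j, (f j - c) ^ 2
      = ∑ j, (f j - a) ^ 2 + 2 * (a - c) * ∑ j, (f j - a) + ∑ _j : Fin K, (a - c) ^ 2 := by
    rw [Finset.mul_sum, ← Finset.sum_add_distrib, ← Finset.sum_add_distrib]
    exact Finset.sum_congr rfl fun j _ => by ring
  rw [h, h0, mul_zero, add_zero]
  exact le_add_of_nonneg_right (Finset.sum_nonneg fun _ _ => sq_nonneg _)

/-- Discrete Poincaré inequality on an interval of `K` sites. -/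
theorem sum_sub_average_sq_le_sum_diff_sq (K : ℕ) (f : ℕ → ℝ) :
    ∑ j : Fin K, (f j - (1 / (K : ℝ)) * ∑ j' : Fin K, f j') ^ 2
      ≤ (K : ℝ) ^ 2 * ∑ j : Fin K, (f (j + 1) - f j) ^ 2 := by
  rw [Fin.sum_univ_eq_sum_range fun j => (f (j + 1) - f j) ^ 2]
  set S := ∑ j ∈ Finset.range K, (f (j + 1) - f j) ^ 2
  have hS0 : 0 ≤ S := Finset.sum_nonneg fun _ _ => sq_nonneg _
  have key : ∀ j : Fin K, (f j - f 0) ^ 2 ≤ K * S := fun j => by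
    have hj : (j : ℕ) ≤ K := j.isLt.le
    rw [← Finset.sum_range_sub f j]
    calc (∑ i ∈ Finset.range j, (f (i + 1) - f i)) ^ 2
        ≤ (j : ℕ) * ∑ i ∈ Finset.range j, (f (i + 1) - f i) ^ 2 := by
          simpa using sq_sum_le_card_mul_sum_sq (s := Finset.range j)
            (f := fun i => f (i + 1) - f i)
      _ ≤ K * S := by
          gcongr
          exact Finset.sum_le_sum_of_subset_of_nonneg (Finset.range_mono hj)
            fun _ _ _ => sq_nonneg _
  calc _ ≤ ∑ j : Fin K, (f j - f 0) ^ 2 := sum_sub_average_sq_le (fun j : Fin K => f j) (f 0)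
    _ ≤ ∑ _j : Fin K, K * S := Finset.sum_le_sum fun j _ => key j
    _ = (K : ℝ) ^ 2 * S := by simp; ring

theorem sum_sub_EP_sq_le (K M : ℕ) (x : Fin (K * M) → ℝ) :
    ∑ i, (x i - EP K M x i) ^ 2 ≤ 1 / (M : ℝ) ^ 2 * ∑ i, Amat (K * M) x i * x i := by
  rcases Nat.eq_zero_or_pos (K * M) with h0 | hN
  · have : IsEmpty (Fin (K * M)) := by rw [h0]; infer_instance
    simp
  have hM : (M : ℝ) ≠ 0 := by
    intro h
    simp [Nat.cast_eq_zero.mp h] at hN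
  have hc : 1 / (M : ℝ) ^ 2 * (((K * M : ℕ) : ℝ) ^ 2 * ∑ i, (x (cyclicShift (K * M) i) - x i) ^ 2)
      = (K : ℝ) ^ 2 * ∑ i, (x (cyclicShift (K * M) i) - x i) ^ 2 := by
    push_cast
    field_simp
  rw [sum_Amat_mul_self, hc, sum_eq_sum_blocks, sum_eq_sum_blocks, Finset.mul_sum]
  refine Finset.sum_le_sum fun i _ => ?_
  simp only [EP_blockIdx]
  let f : ℕ → ℝ := fun j => x ⟨(i * K + j) % (K * M), Nat.mod_lt _ hN⟩
  have hf : ∀ j : Fin K, x (blockIdx K M i j) = f j := fun j =>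
    congrArg x (Fin.ext (Nat.mod_eq_of_lt (blockIdx K M i j).isLt).symm)
  have hf' : ∀ j : Fin K, x (cyclicShift (K * M) (blockIdx K M i j)) = f (j + 1) := fun _ => rfl
  simp only [hf, hf']
  exact sum_sub_average_sq_le_sum_diff_sq K f

theorem sum_sub_EP_sq_le_sum_sq (K M : ℕ) (x : Fin (K * M) → ℝ) :
    ∑ i, (x i - EP K M x i) ^ 2 ≤ ∑ i, x i ^ 2 := by
  rw [sum_eq_sum_blocks, sum_eq_sum_blocks]
  refine Finset.sum_le_sum fun i _ => ?_
  simp only [EP_blockIdx]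
  simpa using sum_sub_average_sq_le (fun j => x (blockIdx K M i j)) 0

/-- `x - E(Px)` is orthogonal to the range of `E`. -/
theorem sum_EP_mul_sub_EP (K M : ℕ) (z x : Fin (K * M) → ℝ) :
    ∑ i, EP K M z i * (x i - EP K M x i) = 0 := by
  rw [sum_eq_sum_blocks]
  refine Finset.sum_eq_zero fun i _ => ?_
  simp only [EP_blockIdx]
  rw [← Finset.mul_sum, sum_sub_average_eq_zero, mul_zero]

/-- There is a universal constant `γ > 0` such that for all `K, M` and
every mean-zero `x ∈ ℝ^{KM}`: `|x - E(Px)|² ≤ (γ/M²)⟨Ax,x⟩` and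
`⟨A⁻¹(x - E(Px)), x - E(Px)⟩ ≤ (γ/M²)|x|²` (the latter phrased through any preimage `z`
of `x - E(Px)` under `A` in the mean-zero subspace). -/
theorem statement11 :
    ∃ γ : ℝ, 0 < γ ∧ ∀ (K M : ℕ) (x : Fin (K * M) → ℝ), (∑ i, x i = 0) →
      ((∑ i, (x i - EP K M x i) ^ 2) ≤ γ / (M : ℝ) ^ 2 * ∑ i, Amat (K * M) x i * x i) ∧
      ∀ z : Fin (K * M) → ℝ, (∑ i, z i = 0) →
        (∀ i, Amat (K * M) z i = x i - EP K M x i) →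
        (∑ i, z i * (x i - EP K M x i)) ≤ γ / (M : ℝ) ^ 2 * ∑ i, (x i) ^ 2 := by
  refine ⟨1, one_pos, fun K M x _ => ⟨sum_sub_EP_sq_le K M x, fun z _ hz => ?_⟩⟩
  have hzw := sum_sub_EP_sq_le K M z
  have hcs := Finset.sum_mul_sq_le_sq_mul_sq Finset.univ (fun i => z i - EP K M z i)
    fun i => x i - EP K M x i
  simp only [hz, mul_comm (x _ - EP K M x _) (z _)] at hzw
  simp only [sub_mul (z _), Finset.sum_sub_distrib, sum_EP_mul_sub_EP, sub_zero] at hcs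
  have hw := sum_sub_EP_sq_le_sum_sq K M x
  set S := ∑ i, z i * (x i - EP K M x i)
  set W := ∑ i, (x i - EP K M x i) ^ 2
  have hW : 0 ≤ W := Finset.sum_nonneg fun _ _ => sq_nonneg _
  have hM : 0 ≤ 1 / (M : ℝ) ^ 2 := by positivity
  refine le_trans ?_ (mul_le_mul_of_nonneg_left hw hM)
  rcases le_or_gt S 0 with hS | hS
  · exact hS.trans (mul_nonneg hM hW)
  · refine le_of_mul_le_mul_left ?_ hS
    calc S * S = S ^ 2 := (sq S).symm
      _ ≤ 1 / (M : ℝ) ^ 2 * S * W := hcs.trans (mul_le_mul_of_nonneg_right hzw hW)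
      _ = S * (1 / (M : ℝ) ^ 2 * W) := by ring
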